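/- arXiv:1501.06543 — 5 statements merged into one kernel-verified Lean document; each statement's English description precedes it below -/
import Mathlib

section
/- Let ℓ ≥ 1, m_A ≥ 1, m_B ≥ 1 be integers with gcd(ℓ·m_A, m_B) = 1, and let a, b be integers with a·ℓ·m_A + b·m_B = 1. Then the map sending the pair (i, j), with 0 ≤ i < m_B and 0 ≤ j < ℓ·m_A, to λ(i,j) = (i·a·ℓ²·m_A + j·b·m_B) mod (ℓ·m_A·m_B) is a bijection from {0,…,m_B−1} × {0,…,ℓ·m_A−1} onto {0,…,ℓ·m_A·m_B−1}. -/
/-- Two elements of `Fin n` whose difference is divisible by `n` are equal. -/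
lemma Fin.eq_of_dvd_intCast_sub {n : ℕ} {x y : Fin n} (h : (n : ℤ) ∣ (x : ℤ) - (y : ℤ)) :
    x = y := by
  have hx := x.isLt
  have hy := y.isLt
  have := Int.eq_zero_of_abs_lt_dvd h (by rw [abs_lt]; constructor <;> omega)
  ext
  omega

/-- The serialization map `λ(i,j) = (i·a·ℓ²·m_A + j·b·m_B) mod (ℓ·m_A·m_B)` is a
bijection from `{0,…,m_B−1} × {0,…,ℓ·m_A−1}` onto `{0,…,ℓ·m_A·m_B−1}`. -/
theorem serialization_bijective (ℓ mA mB : ℕ) (hℓ : 1 ≤ ℓ) (hmA : 1 ≤ mA) (hmB : 1 ≤ mB)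
    (hgcd : Nat.gcd (ℓ * mA) mB = 1) (a b : ℤ)
    (hab : a * ℓ * mA + b * mB = 1) :
    Function.Bijective (fun p : Fin mB × Fin (ℓ * mA) =>
      (⟨(((p.1 : ℤ) * a * ℓ ^ 2 * mA + (p.2 : ℤ) * b * mB) % (ℓ * mA * mB : ℕ)).toNat,
        (by
          have hn : (0 : ℤ) < ((ℓ * mA * mB : ℕ) : ℤ) := by positivity
          have h1 := Int.emod_nonneg ((p.1 : ℤ) * a * ℓ ^ 2 * mA + (p.2 : ℤ) * b * mB) hn.ne'
          have h2 := Int.emod_lt_of_pos ((p.1 : ℤ) * a * ℓ ^ 2 * mA + (p.2 : ℤ) * b * mB) hn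
          omega)⟩ : Fin (ℓ * mA * mB))) := by
  rw [Fintype.bijective_iff_injective_and_card]
  refine ⟨?_, by simp [mul_comm]⟩
  rintro ⟨i, j⟩ ⟨i', j'⟩ h
  have hn : ((ℓ * mA * mB : ℕ) : ℤ) ≠ 0 := by positivity
  simp only [Fin.mk.injEq] at h
  have hmod := congrArg (Nat.cast : ℕ → ℤ) h
  rw [Int.toNat_of_nonneg (Int.emod_nonneg _ hn), Int.toNat_of_nonneg (Int.emod_nonneg _ hn)]
    at hmod
  obtain ⟨k, hk⟩ := (Int.ModEq.symm hmod).dvd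
  push_cast at hk
  have hcop : IsCoprime (mB : ℤ) (ℓ : ℤ) := ⟨b, a * mA, by linear_combination hab⟩
  have hi : (mB : ℤ) ∣ (i : ℤ) - (i' : ℤ) := hcop.dvd_of_dvd_mul_left
    ⟨ℓ * mA * k - b * ((j : ℤ) - j') + ℓ * ((i : ℤ) - i') * b,
      by linear_combination hk - ℓ * ((i : ℤ) - i') * hab⟩
  have hj : ((ℓ * mA : ℕ) : ℤ) ∣ (j : ℤ) - (j' : ℤ) :=
    ⟨mB * k - ((i : ℤ) - i') * a * ℓ + ((j : ℤ) - j') * a,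
      by push_cast; linear_combination hk - ((j : ℤ) - j') * hab⟩
  rw [Fin.eq_of_dvd_intCast_sub hi, Fin.eq_of_dvd_intCast_sub hj]
end

section
/- Let F be a finite field, let ℓ ≥ 1, m_A ≥ 1, m_B ≥ 1 be integers with gcd(ℓ·m_A, m_B) = 1, and let a, b be integers with a·ℓ·m_A + b·m_B = 1. Let A ⊆ F^{ℓ·m_A} be a linear ℓ-quasi-cyclic code and let B ⊆ F^{m_B} be a linear cyclic code. Define C ⊆ F^{ℓ·m_A·m_B} to be the set of vectors c for which there exists a matrix M in the product code A ⊗ B with c_{λ(i,j)} = M_{i,j} for all 0 ≤ i < m_B and 0 ≤ j < ℓ·m_A, where λ(i,j) = (i·a·ℓ²·m_A + j·b·m_B) mod (ℓ·m_A·m_B). Then C is a linear ℓ-quasi-cyclic code of length ℓ·m_A·m_B, i.e., for every c ∈ C the cyclic shift of c by ℓ positions again lies in C. -/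
/-- The index read by `shiftBy ℓ` at `k` is congruent to `k - ℓ` modulo `n`. -/
theorem shiftBy_index_modEq {n : ℕ} (hn : 0 < n) (ℓ k : ℕ) :
    (((k + (n - ℓ % n)) % n : ℕ) : ℤ) ≡ (k : ℤ) - ℓ [ZMOD n] := by
  push_cast [(Nat.mod_lt ℓ hn).le]
  refine (Int.mod_modEq _ _).trans ?_
  rw [Int.modEq_iff_dvd]
  refine ⟨-1 - (ℓ : ℤ) / n, ?_⟩
  linear_combination Int.emod_add_mul_ediv (ℓ : ℤ) n


/-- The cyclic shift of a length-`n` vector by `ℓ` positions: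
`(shiftBy ℓ c) k = c ((k − ℓ) mod n)`. -/
def shiftBy {F : Type*} {n : ℕ} (ℓ : ℕ) (c : Fin n → F) : Fin n → F :=
  fun k => c ⟨((k : ℕ) + (n - ℓ % n)) % n, Nat.mod_lt _ k.pos⟩

/-- **Quasi-cyclicity of the product code** (Wasan).  Let `A` be a linear
`ℓ`-quasi-cyclic code of length `ℓ·m_A` and `B` a linear cyclic code of length
`m_B`, with `gcd(ℓ·m_A, m_B) = 1` and `a·ℓ·m_A + b·m_B = 1`.  The set `C` of
serializations (via `λ(i,j) = (i·a·ℓ²·m_A + j·b·m_B) mod (ℓ·m_A·m_B)`) of the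
codeword matrices of the product code `A ⊗ B` is a linear `ℓ`-quasi-cyclic code
of length `ℓ·m_A·m_B`. -/
theorem product_code_quasi_cyclic (F : Type*) [Field F] [Fintype F]
    (ℓ mA mB : ℕ) (hℓ : 1 ≤ ℓ) (hmA : 1 ≤ mA) (hmB : 1 ≤ mB)
    (hgcd : Nat.gcd (ℓ * mA) mB = 1) (a b : ℤ) (hab : a * ℓ * mA + b * mB = 1)
    (A : Submodule F (Fin (ℓ * mA) → F)) (hA : ∀ c ∈ A, shiftBy ℓ c ∈ A)
    (B : Submodule F (Fin mB → F)) (hB : ∀ c ∈ B, shiftBy 1 c ∈ B)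
    (lam : Fin mB → Fin (ℓ * mA) → Fin (ℓ * mA * mB))
    (hlam : ∀ i j, (lam i j : ℕ) =
      (((i : ℤ) * a * ℓ ^ 2 * mA + (j : ℤ) * b * mB) % (ℓ * mA * mB : ℕ)).toNat)
    (C : Set (Fin (ℓ * mA * mB) → F))
    (hC : C = {c | ∃ M : Fin mB → Fin (ℓ * mA) → F,
      (∀ i, (fun j => M i j) ∈ A) ∧ (∀ j, (fun i => M i j) ∈ B) ∧
      ∀ i j, c (lam i j) = M i j}) :
    (∃ Csub : Submodule F (Fin (ℓ * mA * mB) → F), (Csub : Set (Fin (ℓ * mA * mB) → F)) = C) ∧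
    ∀ c ∈ C, shiftBy ℓ c ∈ C := by
  have hN : 0 < ℓ * mA * mB := by positivity
  have hlam_modEq : ∀ i j, ((lam i j : ℕ) : ℤ) ≡
      (i : ℤ) * a * ℓ ^ 2 * mA + (j : ℤ) * b * mB [ZMOD (ℓ * mA * mB : ℕ)] := by
    intro i j
    rw [hlam, Int.toNat_of_nonneg (Int.emod_nonneg _ (by exact_mod_cast hN.ne'))]
    exact Int.mod_modEq _ _
  have hC_iff : ∀ c, c ∈ C ↔
      (∀ i, (fun j => c (lam i j)) ∈ A) ∧ ∀ j, (fun i => c (lam i j)) ∈ B := by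
    intro c
    rw [hC]
    constructor
    · rintro ⟨M, hMA, hMB, hM⟩
      simpa only [hM] using And.intro hMA hMB
    · rintro ⟨hcA, hcB⟩
      exact ⟨fun i j => c (lam i j), hcA, hcB, fun _ _ => rfl⟩
  refine ⟨⟨{ carrier := C, add_mem' := ?_, zero_mem' := ?_, smul_mem' := ?_ }, rfl⟩, ?_⟩
  · intro c d hc hd
    rw [hC_iff] at hc hd ⊢
    exact ⟨fun i => A.add_mem (hc.1 i) (hd.1 i), fun j => B.add_mem (hc.2 j) (hd.2 j)⟩
  · rw [hC_iff]
    exact ⟨fun _ => A.zero_mem, fun _ => B.zero_mem⟩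
  · intro r c hc
    rw [hC_iff] at hc ⊢
    exact ⟨fun i => A.smul_mem r (hc.1 i), fun j => B.smul_mem r (hc.2 j)⟩
  intro c hc
  rw [hC_iff] at hc ⊢
  let predRow : Fin mB → Fin mB := fun i =>
    ⟨((i : ℕ) + (mB - 1 % mB)) % mB, Nat.mod_lt _ i.pos⟩
  let predCol : Fin (ℓ * mA) → Fin (ℓ * mA) := fun j =>
    ⟨((j : ℕ) + (ℓ * mA - ℓ % (ℓ * mA))) % (ℓ * mA), Nat.mod_lt _ j.pos⟩
  have hshift : ∀ i j, shiftBy ℓ c (lam i j) = c (lam (predRow i) (predCol j)) := by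
    intro i j
    refine congrArg c (Fin.ext ?_)
    refine Nat.ModEq.eq_of_lt_of_lt ?_ (Nat.mod_lt _ hN) (lam _ _).isLt
    rw [← Int.natCast_modEq_iff]
    refine (shiftBy_index_modEq hN ℓ _).trans
      ((((hlam_modEq i j).sub_right _).trans ?_).trans (hlam_modEq _ _).symm)
    obtain ⟨s, hs⟩ := (shiftBy_index_modEq hmB 1 i).symm.dvd
    obtain ⟨t, ht⟩ := (shiftBy_index_modEq (Nat.mul_pos hℓ hmA) ℓ j).symm.dvd
    rw [Int.modEq_iff_dvd]
    refine ⟨s * a * ℓ + t * b, ?_⟩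
    push_cast [predRow, predCol] at hs ht ⊢
    linear_combination (a * ℓ ^ 2 * mA : ℤ) * hs + (b * mB : ℤ) * ht - ℓ * hab
  simp only [hshift]
  exact ⟨fun i => hA _ (hc.1 (predRow i)), fun j => hB _ (hc.2 (predCol j))⟩
end

section
/- Let ℓ ≥ 1, m_A ≥ 1, m_B ≥ 1 be integers and let a, b be integers with a·ℓ·m_A + b·m_B = 1. Define β(i,j) = (i·a·ℓ·m_A + j·b·m_B) mod (m_A·m_B) and λ(i,j') = (i·a·ℓ²·m_A + j'·b·m_B) mod (ℓ·m_A·m_B). Then for all integers i, j and all 0 ≤ h < ℓ, ℓ·(β(i,j) − h·a·m_A) ≡ λ(i, jℓ+h) − h (mod ℓ·m_A·m_B). -/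
/-- Relation between the serialization map `λ` of an `ℓ`-quasi-cyclic product code
and the component serialization map `β`: for `0 ≤ h < ℓ`,
`ℓ·(β(i,j) − h·a·m_A) ≡ λ(i, jℓ+h) − h (mod ℓ·m_A·m_B)`. -/
theorem component_serialization (ℓ mA mB a b : ℤ) (hℓ : 1 ≤ ℓ) (hmA : 1 ≤ mA) (hmB : 1 ≤ mB)
    (hab : a * ℓ * mA + b * mB = 1)
    (β : ℤ → ℤ → ℤ) (hβ : ∀ i j : ℤ, β i j = (i * a * ℓ * mA + j * b * mB) % (mA * mB))
    (lam : ℤ → ℤ → ℤ)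
    (hlam : ∀ i j' : ℤ, lam i j' = (i * a * ℓ ^ 2 * mA + j' * b * mB) % (ℓ * mA * mB))
    (i j h : ℤ) (h0 : 0 ≤ h) (h1 : h < ℓ) :
    ℓ * (β i j - h * a * mA) ≡ lam i (j * ℓ + h) - h [ZMOD ℓ * mA * mB] := by
  rw [hβ, hlam, Int.emod_def, Int.emod_def, Int.modEq_iff_dvd]
  set p := (i * a * ℓ * mA + j * b * mB) / (mA * mB)
  set q := (i * a * ℓ ^ 2 * mA + (j * ℓ + h) * b * mB) / (ℓ * mA * mB)
  exact ⟨p - q, by linear_combination h * hab⟩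
end

section
/- Let F be a field, let ℓ ≥ 1, m_A ≥ 1, m_B ≥ 1 be integers with gcd(ℓ·m_A, m_B) = 1, and let a, b be integers with a·ℓ·m_A + b·m_B = 1. Let M be any m_B × (ℓ·m_A) matrix over F. Define c(X) = Σ_{i=0}^{m_B−1} Σ_{j=0}^{ℓ·m_A−1} M_{i,j} X^{λ(i,j)} ∈ F[X], where λ(i,j) = (i·a·ℓ²·m_A + j·b·m_B) mod (ℓ·m_A·m_B), and let c_0(X), …, c_{ℓ−1}(X) be the unique polynomials of degree less than m_A·m_B with c(X) = Σ_{h=0}^{ℓ−1} c_h(X^ℓ) X^h. Let R = F[X]/(X^{m_A·m_B} − 1) and let X̄ denote the image of X in R, which is a unit of R. Then for every 0 ≤ h < ℓ, the image of c_h in R equals X̄^{−h·a·m_A} · Σ_{i=0}^{m_B−1} Σ_{j=0}^{m_A−1} M_{i, jℓ+h} · X̄^{i·a·ℓ·m_A + j·b·m_B}, where all powers of X̄ with integer (possibly negative) exponents are taken in the group of units of R. -/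
open Polynomial

theorem mk_X_pow_eq_one (F : Type*) [Field F] (N : ℕ) :
    (Ideal.Quotient.mk (Ideal.span {(X : Polynomial F) ^ N - 1}) (X ^ N)) = 1 := by
  have hmem : (X : Polynomial F) ^ N - 1 ∈ Ideal.span {(X : Polynomial F) ^ N - 1} :=
    Ideal.subset_span rfl
  have h0 := Ideal.Quotient.eq_zero_iff_mem.mpr hmem
  rw [map_sub, map_one, sub_eq_zero] at h0
  exact h0

/-- The image `X̄` of `X` in `F[X]/(X^N − 1)`, as a unit of that ring. -/
noncomputable def Xu (F : Type*) [Field F] (N : ℕ) (hN : 0 < N) :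
    (Polynomial F ⧸ Ideal.span {(X : Polynomial F) ^ N - 1})ˣ where
  val := Ideal.Quotient.mk _ X
  inv := Ideal.Quotient.mk _ (X ^ (N - 1))
  val_inv := by
    rw [← map_mul, ← pow_succ', Nat.sub_add_cancel hN]
    exact mk_X_pow_eq_one F N
  inv_val := by
    rw [← map_mul, ← pow_succ, Nat.sub_add_cancel hN]
    exact mk_X_pow_eq_one F N

/-- The index `j·ℓ + h` as an element of `Fin (ℓ·m_A)`. -/
def idx {ℓ mA : ℕ} (j : Fin mA) (h : Fin ℓ) : Fin (ℓ * mA) :=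
  ⟨(j : ℕ) * ℓ + (h : ℕ), by
    calc (j : ℕ) * ℓ + (h : ℕ) < (j : ℕ) * ℓ + ℓ := Nat.add_lt_add_left h.isLt _
    _ = ((j : ℕ) + 1) * ℓ := by ring
    _ ≤ mA * ℓ := Nat.mul_le_mul_right ℓ j.isLt
    _ = ℓ * mA := Nat.mul_comm mA ℓ⟩

theorem idx_uncurry_bijective (ℓ mA : ℕ) :
    Function.Bijective (fun p : Fin ℓ × Fin mA => idx p.2 p.1) := by
  rw [Fintype.bijective_iff_injective_and_card]
  refine ⟨?_, by simp⟩
  rintro ⟨h, j⟩ ⟨h', j'⟩ heq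
  have hval : (j : ℕ) * ℓ + h = j' * ℓ + h' := congrArg Fin.val heq
  have hℓ : 0 < ℓ := h.pos
  have hmod := congrArg (· % ℓ) hval
  have hdiv := congrArg (· / ℓ) hval
  simp only [Nat.mul_add_mod', Nat.mod_eq_of_lt h.isLt, Nat.mod_eq_of_lt h'.isLt] at hmod
  simp only [mul_comm _ ℓ, Nat.mul_add_div hℓ, Nat.div_eq_of_lt h.isLt,
    Nat.div_eq_of_lt h'.isLt, add_zero] at hdiv
  exact Prod.ext (Fin.ext hmod) (Fin.ext hdiv)

theorem sum_fin_mul_eq_sum_idx {A : Type*} [AddCommMonoid A] {ℓ mA : ℕ}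
    (f : Fin (ℓ * mA) → A) :
    ∑ k, f k = ∑ h : Fin ℓ, ∑ j : Fin mA, f (idx j h) := by
  rw [← Fintype.sum_prod_type' (f := fun h j => f (idx j h))]
  exact ((idx_uncurry_bijective ℓ mA).sum_comp f).symm

theorem coeff_sum_comp_X_pow_mul_X_pow {R : Type*} [CommSemiring R] {ℓ : ℕ}
    (p : Fin ℓ → R[X]) (h : Fin ℓ) (n : ℕ) :
    (∑ k : Fin ℓ, (p k).comp (X ^ ℓ) * X ^ (k : ℕ)).coeff (n * ℓ + h) = (p h).coeff n := by
  have hℓ : 0 < ℓ := h.pos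
  rw [finsetSum_coeff, Finset.sum_eq_single h]
  · rw [coeff_mul_X_pow, ← expand_eq_comp_X_pow, coeff_expand_mul hℓ]
  · intro k _ hk
    rw [coeff_mul_X_pow', ← expand_eq_comp_X_pow, coeff_expand hℓ]
    split_ifs with hle hdvd
    · refine absurd (Fin.ext ?_) hk
      obtain ⟨q, hq⟩ := hdvd
      have hval : ℓ * n + (h : ℕ) = ℓ * q + k := by rw [← hq, mul_comm]; omega
      have hmod := congrArg (· % ℓ) hval
      simpa [Nat.mod_eq_of_lt h.isLt, Nat.mod_eq_of_lt k.isLt] using hmod.symm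
    · rfl
    · rfl
  · simp

theorem eq_of_sum_comp_X_pow_mul_X_pow_eq {R : Type*} [CommSemiring R] {ℓ : ℕ}
    {p q : Fin ℓ → R[X]}
    (hpq : ∑ k : Fin ℓ, (p k).comp (X ^ ℓ) * X ^ (k : ℕ) =
      ∑ k : Fin ℓ, (q k).comp (X ^ ℓ) * X ^ (k : ℕ)) : p = q := by
  ext h n
  rw [← coeff_sum_comp_X_pow_mul_X_pow p, hpq, coeff_sum_comp_X_pow_mul_X_pow]

theorem toNat_mul_add_emod {ℓ N h : ℕ} (hN : 0 < N) (hh : h < ℓ) (e : ℤ) :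
    ((ℓ * e + h) % (ℓ * N : ℕ)).toNat = ℓ * (e % N).toNat + h := by
  have hN' : (0 : ℤ) < N := by exact_mod_cast hN
  have h0 := Int.emod_nonneg e hN'.ne'
  have h1 := Int.emod_lt_of_pos e hN'
  have key : (ℓ * e + h) % (ℓ * N : ℕ) = ℓ * (e % N) + h := by
    have hsplit : (ℓ * e + h : ℤ) = (ℓ * (e % N) + h) + (ℓ * N : ℕ) * (e / N) := by
      push_cast
      linear_combination -(ℓ : ℤ) * Int.emod_add_mul_ediv e N
    rw [hsplit, Int.add_mul_emod_self_left]
    have hh' : (h : ℤ) < ℓ := by exact_mod_cast hh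
    apply Int.emod_eq_of_lt
    · positivity
    · push_cast
      nlinarith
  rw [key]
  zify
  rw [Int.toNat_of_nonneg (by positivity), Int.toNat_of_nonneg h0]

theorem Xu_pow_self (F : Type*) [Field F] (N : ℕ) (hN : 0 < N) : Xu F N hN ^ N = 1 := by
  ext
  rw [Units.val_pow_eq_pow_val, Units.val_one, ← mk_X_pow_eq_one F N, map_pow]
  rfl

theorem mk_X_pow_toNat_emod (F : Type*) [Field F] (N : ℕ) (hN : 0 < N) (e : ℤ) :
    Ideal.Quotient.mk (Ideal.span {(X : F[X]) ^ N - 1}) (X ^ (e % N).toNat) =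
      ↑(Xu F N hN ^ e) := by
  have hpow : Xu F N hN ^ e = Xu F N hN ^ (e % N).toNat := by
    rw [← zpow_natCast, Int.toNat_of_nonneg (Int.emod_nonneg e (by exact_mod_cast hN.ne'))]
    exact zpow_eq_zpow_emod e (by exact_mod_cast Xu_pow_self F N hN)
  rw [hpow, Units.val_pow_eq_pow_val, map_pow]
  rfl

/-- **Mapping to `ℓ` univariate polynomials.**  The components `c_h` of the
serialized product codeword `c(X) = Σ_{i,j} M_{i,j} X^{λ(i,j)}` satisfy, in
`R = F[X]/(X^{m_A·m_B} − 1)`,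
`c̄_h = X̄^{−h·a·m_A} · Σ_i Σ_j M_{i,jℓ+h} X̄^{i·a·ℓ·m_A + j·b·m_B}`. -/
theorem components_of_serialized_product_codeword (F : Type*) [Field F]
    (ℓ mA mB : ℕ) (hℓ : 1 ≤ ℓ) (hmA : 1 ≤ mA) (hmB : 1 ≤ mB)
    (hgcd : Nat.gcd (ℓ * mA) mB = 1) (a b : ℤ) (hab : a * ℓ * mA + b * mB = 1)
    (M : Fin mB → Fin (ℓ * mA) → F)
    (c : Polynomial F)
    (hc : c = ∑ i : Fin mB, ∑ j : Fin (ℓ * mA),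
      C (M i j) * X ^ ((((i : ℤ) * a * ℓ ^ 2 * mA + (j : ℤ) * b * mB) %
        (ℓ * mA * mB : ℕ)).toNat))
    (cH : Fin ℓ → Polynomial F)
    (hdeg : ∀ h : Fin ℓ, (cH h).degree < (mA * mB : ℕ))
    (hsum : c = ∑ h : Fin ℓ, (cH h).comp (X ^ ℓ) * X ^ (h : ℕ)) :
    ∀ h : Fin ℓ,
      Ideal.Quotient.mk (Ideal.span {(X : Polynomial F) ^ (mA * mB) - 1}) (cH h) =
      ↑(Xu F (mA * mB) (Nat.mul_pos hmA hmB) ^ (-((h : ℕ) : ℤ) * a * mA)) *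
        ∑ i : Fin mB, ∑ j : Fin mA,
          Ideal.Quotient.mk (Ideal.span {(X : Polynomial F) ^ (mA * mB) - 1})
              (C (M i (idx j h))) *
            ↑(Xu F (mA * mB) (Nat.mul_pos hmA hmB) ^
              ((i : ℤ) * a * ℓ * mA + (j : ℤ) * b * mB)) := by
  have hN : 0 < mA * mB := Nat.mul_pos hmA hmB
  have hcomp : cH = fun h => ∑ i : Fin mB, ∑ j : Fin mA, C (M i (idx j h)) *
      X ^ ((-((h : ℕ) : ℤ) * a * mA + ((i : ℤ) * a * ℓ * mA + (j : ℤ) * b * mB)) %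
        (mA * mB : ℕ)).toNat := by
    apply eq_of_sum_comp_X_pow_mul_X_pow_eq
    rw [← hsum, hc]
    simp only [sum_fin_mul_eq_sum_idx]
    rw [Finset.sum_comm]
    refine Finset.sum_congr rfl fun h _ => ?_
    rw [Polynomial.sum_comp, Finset.sum_mul]
    refine Finset.sum_congr rfl fun i _ => ?_
    rw [Polynomial.sum_comp, Finset.sum_mul]
    refine Finset.sum_congr rfl fun j _ => ?_
    rw [mul_comp, C_comp, X_pow_comp, ← pow_mul, mul_assoc (C _), ← pow_add,
      ← toNat_mul_add_emod hN h.isLt, ← mul_assoc ℓ mA mB]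
    congr 4
    simp only [idx]
    push_cast
    linear_combination (h : ℤ) * hab
  intro h
  rw [hcomp]
  simp only [map_sum, map_mul, mk_X_pow_toNat_emod F _ hN, zpow_add _ (-((h : ℕ) : ℤ) * a * mA),
    Units.val_mul, Finset.mul_sum]
  refine Finset.sum_congr rfl fun i _ => Finset.sum_congr rfl fun j _ => ?_
  ring
end

section
/- Let F be a field, let ℓ ≥ 1, m_A ≥ 1, m_B ≥ 1 be integers with gcd(ℓ·m_A, m_B) = 1, and let a, b be integers with a·ℓ·m_A + b·m_B = 1. Let g^B ∈ F[X] divide X^{m_B} − 1, and let M be an m_B × (ℓ·m_A) matrix over F such that every column of M is a codeword of the cyclic code generated by g^B, i.e., for every 0 ≤ j < ℓ·m_A the polynomial Σ_{i=0}^{m_B−1} M_{i,j} X^i is divisible by g^B in F[X]. Let R = F[X]/(X^{m_A·m_B} − 1) with X̄ the (unit) image of X and u = X̄^{a·ℓ·m_A}. Then for every 0 ≤ h < ℓ, the element Σ_{i=0}^{m_B−1} Σ_{j=0}^{m_A−1} M_{i, jℓ+h} · X̄^{i·a·ℓ·m_A + j·b·m_B} of R lies in the ideal of R generated by g^B(u),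 the evaluation of g^B at u. -/
open Polynomial

/-- If every column of the codeword matrix `M` lies in the cyclic code generated
by `g^B`, then each serialized component sum lies in the ideal of
`R = F[X]/(X^{m_A·m_B} − 1)` generated by `g^B(u)`, where `u = X̄^{a·ℓ·m_A}`. -/
theorem component_in_column_code_ideal (F : Type*) [Field F]
    (ℓ mA mB : ℕ) (hℓ : 1 ≤ ℓ) (hmA : 1 ≤ mA) (hmB : 1 ≤ mB)
    (hgcd : Nat.gcd (ℓ * mA) mB = 1) (a b : ℤ) (hab : a * ℓ * mA + b * mB = 1)
    (gB : Polynomial F) (hgB : gB ∣ X ^ mB - 1)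
    (M : Fin mB → Fin (ℓ * mA) → F)
    (hcol : ∀ j : Fin (ℓ * mA), gB ∣ ∑ i : Fin mB, C (M i j) * X ^ (i : ℕ)) :
    ∀ h : Fin ℓ,
      (∑ i : Fin mB, ∑ j : Fin mA,
        Ideal.Quotient.mk (Ideal.span {(X : Polynomial F) ^ (mA * mB) - 1})
            (C (M i (idx j h))) *
          ↑(Xu F (mA * mB) (Nat.mul_pos hmA hmB) ^
            ((i : ℤ) * a * ℓ * mA + (j : ℤ) * b * mB))) ∈
      Ideal.span {(Polynomial.aeval
        (↑(Xu F (mA * mB) (Nat.mul_pos hmA hmB) ^ (a * ℓ * mA)) :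
          Polynomial F ⧸ Ideal.span {(X : Polynomial F) ^ (mA * mB) - 1}) gB)} := by
  intro h
  set x := Xu F (mA * mB) (Nat.mul_pos hmA hmB)
  rw [Finset.sum_comm]
  refine Ideal.sum_mem _ fun j _ => ?_
  have key : ∀ i : Fin mB,
      Ideal.Quotient.mk (Ideal.span {(X : Polynomial F) ^ (mA * mB) - 1})
          (C (M i (idx j h))) *
        ↑(x ^ ((i : ℤ) * a * ℓ * mA + (j : ℤ) * b * mB)) =
      ↑(x ^ ((j : ℤ) * b * mB)) *
        aeval (↑(x ^ (a * ℓ * mA)) :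
          Polynomial F ⧸ Ideal.span {(X : Polynomial F) ^ (mA * mB) - 1})
          (C (M i (idx j h)) * X ^ (i : ℕ)) := by
    intro i
    have hexp : (i : ℤ) * a * ℓ * mA + (j : ℤ) * b * mB =
        (j : ℤ) * b * mB + a * ℓ * mA * ((i : ℕ) : ℤ) := by ring
    rw [hexp, zpow_add, zpow_mul x (a * ℓ * mA), zpow_natCast, map_mul, aeval_C, map_pow, aeval_X,
      Units.val_mul, Units.val_pow_eq_pow_val, mul_left_comm]
    rfl
  rw [Finset.sum_congr rfl fun i _ => key i, ← Finset.mul_sum, ← map_sum]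
  exact Ideal.mul_mem_left _ _ (Ideal.mem_span_singleton.mpr (map_dvd _ (hcol (idx j h))))
end
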